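/- Let a, b ≥ 3 and c ≥ 2 with n = a + b + c − 2 ≥ 7, and let G_2(a,b,c) be the bicyclic graph obtained from disjoint cycles C_a and C_b and a path P_c by identifying one endpoint of the path with a vertex of C_a and the other endpoint with a vertex of C_b. Then S_k(G_2(a,b,c)) ≤ S_k(B_n) for every k ≥ 1. -/

import Mathlib

open SimpleGraph

/-- `S_k(G)`: the number of connected sets of `G` of cardinality `k`. -/
noncomputable def connCount {V : Type} (G : SimpleGraph V) (k : ℕ) : ℕ :=
  Nat.card {S : Finset V // S.card = k ∧ (G.induce (S : Set V)).Connected}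

/-- `G₂(a,b,c)`: the bicyclic graph on `{0,…,n−1}` (`n = a+b+c−2`) whose edges form the
cycle `0,1,…,a−1,0`, the cycle `a,a+1,…,a+b−1,a`, and a path from vertex `0` to vertex
`a` through the `c−2` vertices `a+b,…,n−1` (when `c = 2` the path is just the edge
`{0,a}`). -/
def G2graph (a b c : ℕ) : SimpleGraph (Fin (a + b + c - 2)) :=
  SimpleGraph.fromRel (fun x y =>
    (y.val = x.val + 1 ∧ y.val ≤ a - 1) ∨ (x.val = a - 1 ∧ y.val = 0) ∨
      (y.val = x.val + 1 ∧ a ≤ x.val ∧ y.val ≤ a + b - 1) ∨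
      (x.val = a + b - 1 ∧ y.val = a) ∨
      (c = 2 ∧ x.val = 0 ∧ y.val = a) ∨
      (2 < c ∧ ((x.val = 0 ∧ y.val = a + b) ∨
        (y.val = x.val + 1 ∧ a + b ≤ x.val) ∨
        (x.val = a + b + c - 3 ∧ y.val = a))))

/-- `B_n`: on `{0,…,n−1}`, vertex `0` is adjacent to each of `1,…,n−2`, vertices `1` and
`2` are adjacent, vertex `n−1` is adjacent to vertices `0` and `1`. -/
def Bgraph (n : ℕ) : SimpleGraph (Fin n) :=
  SimpleGraph.fromRel (fun a b =>
    a.val = 0 ∨ (a.val = 1 ∧ b.val = 2) ∨ (a.val = n - 1 ∧ b.val = 1))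

lemma cross {V : Type} {G : SimpleGraph V} {S : Finset V}
    (h : (G.induce (S : Set V)).Connected) (P : V → Prop) {x y : V} (hx : x ∈ S) (hy : y ∈ S)
    (px : P x) (py : ¬ P y) : ∃ u ∈ S, ∃ v ∈ S, P u ∧ ¬ P v ∧ G.Adj u v := by
  obtain ⟨p⟩ := h.preconnected ⟨x, hx⟩ ⟨y, hy⟩
  obtain ⟨d, -, h1, h2⟩ := p.exists_boundary_dart {v | P v.1} px py
  exact ⟨d.fst.1, d.fst.2, d.snd.1, d.snd.2, h1, h2, d.adj⟩

/-- one-directional edge relation -/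
def Erel (a b c x y : ℕ) : Prop :=
  (y = x + 1 ∧ y ≤ a - 1) ∨ (x = a - 1 ∧ y = 0) ∨
      (y = x + 1 ∧ a ≤ x ∧ y ≤ a + b - 1) ∨
      (x = a + b - 1 ∧ y = a) ∨
      (c = 2 ∧ x = 0 ∧ y = a) ∨
      (2 < c ∧ ((x = 0 ∧ y = a + b) ∨
        (y = x + 1 ∧ a + b ≤ x) ∨
        (x = a + b + c - 3 ∧ y = a)))

lemma adj_iff (a b c : ℕ) (x y : Fin (a + b + c - 2)) :
    (G2graph a b c).Adj x y ↔ x ≠ y ∧ (Erel a b c x.1 y.1 ∨ Erel a b c y.1 x.1) := by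
  simp only [G2graph, SimpleGraph.fromRel_adj, Erel]

abbrev Conn2 (a b c : ℕ) (S : Finset (Fin (a + b + c - 2))) : Prop :=
  ((G2graph a b c).induce (S : Set (Fin (a + b + c - 2)))).Connected

lemma crossN {a b c : ℕ} {S : Finset (Fin (a + b + c - 2))} (h : Conn2 a b c S) (P : ℕ → Prop)
    {x y : Fin (a + b + c - 2)} (hx : x ∈ S) (hy : y ∈ S)
    (px : P x.1) (py : ¬ P y.1) : ∃ u ∈ S, ∃ v ∈ S, P u.1 ∧ ¬ P v.1 ∧
      (Erel a b c u.1 v.1 ∨ Erel a b c v.1 u.1) := by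
  obtain ⟨u, hu, v, hv, h1, h2, h3⟩ := cross h (fun v => P v.1) hx hy px py
  exact ⟨u, hu, v, hv, h1, h2, ((adj_iff _ _ _ _ _).1 h3).2⟩

section
variable {a b c : ℕ} {S : Finset (Fin (a + b + c - 2))}

lemma L1 (ha : 3 ≤ a) (hb : 3 ≤ b) (hc : 2 ≤ c) (h : Conn2 a b c S) (h0 : ∀ v ∈ S, v.1 ≠ 0)
    {x y : Fin (a + b + c - 2)} (hx : x ∈ S) (hy : y ∈ S) (hxa : x.1 < a) : y.1 < a := by
  by_contra hya
  obtain ⟨u, hu, v, hv, h1, h2, h3⟩ := crossN h (fun v => v < a) hx hy hxa hya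
  have := h0 u hu
  have := h0 v hv
  have := v.2
  have := u.2
  unfold Erel at h3
  omega

lemma L2 (ha : 3 ≤ a) (hb : 3 ≤ b) (hc : 2 ≤ c) (h : Conn2 a b c S) (h0 : ∀ v ∈ S, v.1 ≠ a)
    {x y : Fin (a + b + c - 2)} (hx : x ∈ S) (hy : y ∈ S) (hxa : a < x.1) (hxb : x.1 < a + b) :
    a < y.1 ∧ y.1 < a + b := by
  by_contra hya
  obtain ⟨u, hu, v, hv, h1, h2, h3⟩ := crossN h (fun v => a < v ∧ v < a + b) hx hy ⟨hxa, hxb⟩ hya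
  have := h0 u hu
  have := h0 v hv
  have := v.2
  have := u.2
  try simp only at h1 h2
  unfold Erel at h3
  omega

lemma L3 (ha : 3 ≤ a) (hb : 3 ≤ b) (hc : 2 ≤ c) (h : Conn2 a b c S)
    (h0 : ∀ v ∈ S, v.1 ≠ 0) (h1 : ∀ v ∈ S, v.1 ≠ a + b + c - 3)
    {x y : Fin (a + b + c - 2)} (hx : x ∈ S) (hy : y ∈ S) (hxa : a + b ≤ x.1) : a + b ≤ y.1 := by
  by_contra hya
  obtain ⟨u, hu, v, hv, h4, h2, h3⟩ := crossN h (fun v => a + b ≤ v) hx hy hxa hya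
  have := h0 u hu
  have := h0 v hv
  have := h1 u hu
  have := h1 v hv
  have := v.2
  have := u.2
  unfold Erel at h3
  omega

end

/-- position -/
def pos (a n v : ℕ) : ℕ := if v = a then n else v

lemma interval {a n k : ℕ} (S : Finset (Fin n)) (hk : S.card = k) (hk1 : 1 ≤ k)
    (hconv : ∀ x ∈ S, ∀ z ∈ S, ∀ y : ℕ, pos a n x.1 < y → y < pos a n z.1 →
      ∃ v ∈ S, pos a n v.1 = y) :
    ∃ i, (∀ v, v ∈ S ↔ i ≤ pos a n v.1 ∧ pos a n v.1 < i + k) ∧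
      (∃ x ∈ S, pos a n x.1 = i) ∧ (∃ z ∈ S, pos a n z.1 + 1 = i + k) := by
  have inj : ∀ u v : Fin n, pos a n u.1 = pos a n v.1 → u = v := by
    intro u v h
    apply Fin.ext
    have := u.2
    have := v.2
    unfold pos at h
    split_ifs at h <;> omega
  set T := S.image (fun v => pos a n v.1) with hT
  have hTc : T.card = k := by
    rw [hT, Finset.card_image_of_injective _ (fun u v h => inj u v h), hk]
  have hne : T.Nonempty := by
    rw [← Finset.card_pos]; omega
  have hmemT : ∀ v : Fin n, pos a n v.1 ∈ T ↔ v ∈ S := by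
    intro v
    simp only [hT, Finset.mem_image]
    constructor
    · rintro ⟨u, hu, h⟩
      exact inj _ _ h ▸ hu
    · intro h
      exact ⟨v, h, rfl⟩
  obtain ⟨x, hx, hx'⟩ := Finset.mem_image.1 (T.min'_mem hne)
  obtain ⟨z, hz, hz'⟩ := Finset.mem_image.1 (T.max'_mem hne)
  have hI : T = Finset.Icc (T.min' hne) (T.max' hne) := by
    ext y
    rw [Finset.mem_Icc]
    constructor
    · intro hy
      exact ⟨T.min'_le y hy, T.le_max' y hy⟩
    · rintro ⟨h1, h2⟩
      rcases h1.eq_or_lt with h1 | h1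
      · rw [← h1]; exact T.min'_mem hne
      rcases h2.eq_or_lt with h2 | h2
      · rw [h2]; exact T.max'_mem hne
      obtain ⟨v, hv, h⟩ := hconv x hx z hz y (hx' ▸ h1) (hz' ▸ h2)
      rw [← h, hmemT]; exact hv
  have hcard : T.max' hne + 1 - T.min' hne = k := by
    rw [← hTc]; conv_rhs => rw [hI]
    simp
  have hle : T.min' hne ≤ T.max' hne := T.min'_le _ (T.max'_mem hne)
  refine ⟨T.min' hne, ?_, ⟨x, hx, hx'⟩, ⟨z, hz, by omega⟩⟩
  intro v
  rw [← hmemT v]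
  have : pos a n v.1 ∈ T ↔ pos a n v.1 ∈ Finset.Icc (T.min' hne) (T.max' hne) := by rw [← hI]
  rw [this, Finset.mem_Icc]
  omega

/-- segment type -/
def Seg (a b c k i e : ℕ) : Prop :=
  (1 ≤ i ∧ i + k ≤ a ∧ e = a + 1) ∨ (a + 1 ≤ i ∧ i + k ≤ a + b ∧ e = a - 1) ∨
  (a + b ≤ i ∧ i + k ≤ a + b + c - 2 + 1 ∧ e = a + 1)

/-- the matching relation -/
def MRel (a b c k : ℕ) (S S' : Finset (Fin (a + b + c - 2))) : Prop :=
  ((∃ z ∈ S, z.1 = 0) ∧ S' = S) ∨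
  ((∀ z ∈ S, z.1 ≠ 0) ∧ (∃ z ∈ S, z.1 = a) ∧ (∃ y ∈ S, a < y.1 ∧ y.1 < a + b) ∧
    ∀ v, v ∈ S' ↔ (v.1 = 0 ∨ (v ∈ S ∧ v.1 ≠ a))) ∨
  (∃ i e, Seg a b c k i e ∧
    (∀ v, v ∈ S ↔ i ≤ pos a (a + b + c - 2) v.1 ∧ pos a (a + b + c - 2) v.1 < i + k) ∧
    (∀ v, v ∈ S' ↔ (v.1 = 0 ∨ v.1 = e ∨ (i ≤ v.1 ∧ v.1 + 2 < i + k))))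

lemma seg_of {a b c k : ℕ} {S : Finset (Fin (a + b + c - 2))} (ha : 3 ≤ a) (hb : 3 ≤ b)
    (hc : 2 ≤ c) (hk : 3 ≤ k) (hS : S.card = k) (h : Conn2 a b c S)
    (hs : (∀ v ∈ S, 0 < v.1 ∧ v.1 < a) ∨ (∀ v ∈ S, a < v.1 ∧ v.1 < a + b) ∨
      (∀ v ∈ S, v.1 = a ∨ a + b ≤ v.1)) :
    ∃ i e, Seg a b c k i e ∧
      (∀ v, v ∈ S ↔ i ≤ pos a (a + b + c - 2) v.1 ∧ pos a (a + b + c - 2) v.1 < i + k) := by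
  obtain ⟨i, h1, ⟨x, hx, hx'⟩, ⟨z, hz, hz'⟩⟩ := interval (a := a) S hS (by omega) (by
    intro x hx z hz y hxy hyz
    have hxs := x.2
    have hzs := z.2
    by_contra hcon
    have hno : ∀ v ∈ S, pos a (a + b + c - 2) v.1 ≠ y := fun v hv hh => hcon ⟨v, hv, hh⟩
    obtain ⟨u, hu, v, hv, h4, h2, h3⟩ := crossN h (fun v => pos a (a + b + c - 2) v < y) hx hz
      hxy (by omega)
    have := hno u hu
    have := hno v hv
    have := u.2
    have := v.2
    try simp only at h4 h2
    unfold pos at *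
    unfold Erel at h3
    rcases hs with hs | hs | hs
    all_goals
      have := hs x hx
      have := hs z hz
      have := hs u hu
      have := hs v hv
      split_ifs at * <;> omega)
  have hxs := x.2
  have hzs := z.2
  unfold pos at hx' hz'
  rcases hs with hs | hs | hs
  · have := hs x hx
    have := hs z hz
    refine ⟨i, a + 1, Or.inl ?_, h1⟩
    split_ifs at * <;> omega
  · have := hs x hx
    have := hs z hz
    refine ⟨i, a - 1, Or.inr (Or.inl ?_), h1⟩
    split_ifs at * <;> omega
  · have := hs x hx
    have := hs z hz
    refine ⟨i, a + 1, Or.inr (Or.inr ?_), h1⟩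
    split_ifs at * <;> omega

lemma rel_seg {a b c k i e : ℕ} {S : Finset (Fin (a + b + c - 2))} (ha : 3 ≤ a) (hb : 3 ≤ b)
    (hc : 2 ≤ c) (hk : 3 ≤ k) (hseg : Seg a b c k i e)
    (hS : ∀ v, v ∈ S ↔ i ≤ pos a (a + b + c - 2) v.1 ∧ pos a (a + b + c - 2) v.1 < i + k) :
    ∃ S', S'.card = k ∧ (∃ z ∈ S', z.1 = 0) ∧ MRel a b c k S S' := by
  unfold Seg at hseg
  have hlt : ∀ m ∈ insert 0 (insert e (Finset.Ico i (i + k - 2))), m < a + b + c - 2 := by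
    intro m hm
    simp only [Finset.mem_insert, Finset.mem_Ico] at hm
    omega
  refine ⟨Finset.attachFin _ hlt, ?_, ⟨⟨0, by omega⟩, by simp, rfl⟩,
    Or.inr (Or.inr ⟨i, e, hseg, hS, ?_⟩)⟩
  · rw [Finset.card_attachFin, Finset.card_insert_of_notMem, Finset.card_insert_of_notMem]
    · simp; omega
    · simp; omega
    · simp; omega
  · intro v
    simp only [Finset.mem_attachFin, Finset.mem_insert, Finset.mem_Ico]
    omega

lemma rel_exists {a b c k : ℕ} {S : Finset (Fin (a + b + c - 2))} (ha : 3 ≤ a) (hb : 3 ≤ b)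
    (hc : 2 ≤ c) (hk : 3 ≤ k) (hS : S.card = k) (h : Conn2 a b c S) :
    ∃ S', S'.card = k ∧ (∃ z ∈ S', z.1 = 0) ∧ MRel a b c k S S' := by
  by_cases h0 : ∃ z ∈ S, z.1 = 0
  · exact ⟨S, hS, h0, Or.inl ⟨h0, rfl⟩⟩
  have h0' : ∀ z ∈ S, z.1 ≠ 0 := fun z hz hh => h0 ⟨z, hz, hh⟩
  have fin : ((∀ v ∈ S, 0 < v.1 ∧ v.1 < a) ∨ (∀ v ∈ S, a < v.1 ∧ v.1 < a + b) ∨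
      (∀ v ∈ S, v.1 = a ∨ a + b ≤ v.1)) →
      ∃ S', S'.card = k ∧ (∃ z ∈ S', z.1 = 0) ∧ MRel a b c k S S' := by
    intro hs
    obtain ⟨i, e, h1, h2⟩ := seg_of ha hb hc hk hS h hs
    exact rel_seg ha hb hc hk h1 h2
  by_cases hA : ∃ x ∈ S, x.1 < a
  · obtain ⟨x, hx, hxa⟩ := hA
    exact fin (Or.inl fun v hv => ⟨Nat.pos_of_ne_zero (h0' v hv), L1 ha hb hc h h0' hx hv hxa⟩)
  have hA' : ∀ z ∈ S, a ≤ z.1 := fun z hz => not_lt.1 fun hh => hA ⟨z, hz, hh⟩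
  by_cases hB : ∃ y ∈ S, a < y.1 ∧ y.1 < a + b
  · by_cases ha' : ∃ z ∈ S, z.1 = a
    · obtain ⟨z, hz, hza⟩ := ha'
      refine ⟨insert ⟨0, by omega⟩ (S.erase z), ?_, ⟨⟨0, by omega⟩, by simp, rfl⟩,
        Or.inr (Or.inl ⟨h0', ⟨z, hz, hza⟩, hB, ?_⟩)⟩
      · rw [Finset.card_insert_of_notMem, Finset.card_erase_of_mem hz]
        · omega
        · intro hh
          exact h0' _ (Finset.mem_of_mem_erase hh) rfl
      · intro v
        simp only [Finset.mem_insert, Finset.mem_erase, Fin.ext_iff, ne_eq, hza]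
        tauto
    · obtain ⟨y, hy, hy1, hy2⟩ := hB
      exact fin (Or.inr (Or.inl fun v hv =>
        L2 ha hb hc h (fun z hz hh => ha' ⟨z, hz, hh⟩) hy hv hy1 hy2))
  · refine fin (Or.inr (Or.inr fun v hv => ?_))
    have := hA' v hv
    by_contra hh
    exact hB ⟨v, hv, by omega⟩

section
variable {a b c k : ℕ} {S T U : Finset (Fin (a + b + c - 2))}

lemma rel_12 (ha : 3 ≤ a) (hb : 3 ≤ b) (hc : 2 ≤ c) (hU : Conn2 a b c U)
    (h0 : ∃ z ∈ U, z.1 = 0)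
    (hT : (∀ z ∈ T, z.1 ≠ 0) ∧ (∃ z ∈ T, z.1 = a) ∧ (∃ y ∈ T, a < y.1 ∧ y.1 < a + b) ∧
    ∀ v, v ∈ U ↔ (v.1 = 0 ∨ (v ∈ T ∧ v.1 ≠ a))) : False := by
  obtain ⟨-, -, ⟨y, hy, hy1, hy2⟩, h⟩ := hT
  obtain ⟨z, hz, hz0⟩ := h0
  have := L2 ha hb hc hU (fun v hv => by have := (h v).1 hv; omega)
    ((h y).2 (Or.inr ⟨hy, by omega⟩)) hz hy1 hy2
  omega

lemma rel_13 (ha : 3 ≤ a) (hb : 3 ≤ b) (hc : 2 ≤ c) (hk : 3 ≤ k) (hU : Conn2 a b c U)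
    (h0 : ∃ z ∈ U, z.1 = 0)
    (hT : ∃ i e, Seg a b c k i e ∧
    (∀ v, v ∈ T ↔ i ≤ pos a (a + b + c - 2) v.1 ∧ pos a (a + b + c - 2) v.1 < i + k) ∧
    (∀ v, v ∈ U ↔ (v.1 = 0 ∨ v.1 = e ∨ (i ≤ v.1 ∧ v.1 + 2 < i + k)))) : False := by
  obtain ⟨i, e, hs, -, h⟩ := hT
  obtain ⟨z, hz, hz0⟩ := h0
  unfold Seg at hs
  have hno : ∀ v ∈ U, v.1 ≠ a := fun v hv => by have := (h v).1 hv; omega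
  have : ∃ y ∈ U, a < y.1 ∧ y.1 < a + b := by
    rcases hs with hs | hs | hs
    · exact ⟨⟨e, by omega⟩, (h _).2 (by simp), by simp; omega⟩
    · exact ⟨⟨i, by omega⟩, (h _).2 (by simp; omega), by simp; omega⟩
    · exact ⟨⟨e, by omega⟩, (h _).2 (by simp), by simp; omega⟩
  obtain ⟨y, hy, hy1, hy2⟩ := this
  have := L2 ha hb hc hU hno hy hz hy1 hy2
  omega

lemma rel_23 (ha : 3 ≤ a) (hb : 3 ≤ b) (hc : 2 ≤ c) (hk : 3 ≤ k) (hS : Conn2 a b c S)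
    (h2 : (∀ z ∈ S, z.1 ≠ 0) ∧ (∃ z ∈ S, z.1 = a) ∧ (∃ y ∈ S, a < y.1 ∧ y.1 < a + b) ∧
    ∀ v, v ∈ U ↔ (v.1 = 0 ∨ (v ∈ S ∧ v.1 ≠ a)))
    (hT : ∃ i e, Seg a b c k i e ∧
    (∀ v, v ∈ T ↔ i ≤ pos a (a + b + c - 2) v.1 ∧ pos a (a + b + c - 2) v.1 < i + k) ∧
    (∀ v, v ∈ U ↔ (v.1 = 0 ∨ v.1 = e ∨ (i ≤ v.1 ∧ v.1 + 2 < i + k)))) : False := by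
  obtain ⟨i, e, hs, -, h⟩ := hT
  obtain ⟨h0, ⟨z, hz, hza⟩, -, h'⟩ := h2
  unfold Seg at hs
  have key : ∀ v : Fin (a + b + c - 2), v.1 ≠ 0 →
      (v.1 = e ∨ (i ≤ v.1 ∧ v.1 + 2 < i + k)) → v ∈ S := by
    intro v hv hh
    have := (h' v).1 ((h v).2 (Or.inr hh))
    tauto
  rcases hs with hs | hs | hs
  · have := L1 ha hb hc hS h0 (key ⟨i, by omega⟩ (by simp; omega) (by simp; omega)) hz
      (by simp; omega)
    omega
  · have := L1 ha hb hc hS h0 (key ⟨e, by omega⟩ (by simp; omega) (by simp)) hz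
      (by simp; omega)
    omega
  · have := L3 ha hb hc hS h0 (by
      intro v hv hh
      have := (h v).1 ((h' v).2 (Or.inr ⟨hv, by omega⟩))
      omega) (key ⟨i, by omega⟩ (by simp; omega) (by simp; omega)) hz (by simp; omega)
    omega

lemma rel_33 (ha : 3 ≤ a) (hb : 3 ≤ b) (hc : 2 ≤ c) (hk : 3 ≤ k)
    (hS : ∃ i e, Seg a b c k i e ∧
    (∀ v, v ∈ S ↔ i ≤ pos a (a + b + c - 2) v.1 ∧ pos a (a + b + c - 2) v.1 < i + k) ∧
    (∀ v, v ∈ U ↔ (v.1 = 0 ∨ v.1 = e ∨ (i ≤ v.1 ∧ v.1 + 2 < i + k))))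
    (hT : ∃ i e, Seg a b c k i e ∧
    (∀ v, v ∈ T ↔ i ≤ pos a (a + b + c - 2) v.1 ∧ pos a (a + b + c - 2) v.1 < i + k) ∧
    (∀ v, v ∈ U ↔ (v.1 = 0 ∨ v.1 = e ∨ (i ≤ v.1 ∧ v.1 + 2 < i + k)))) : S = T := by
  obtain ⟨i, e, hs, h1, h2⟩ := hS
  obtain ⟨j, f, ht, h3, h4⟩ := hT
  unfold Seg at hs ht
  have hi : i < a + b + c - 2 := by omega
  have hj : j < a + b + c - 2 := by omega
  have he : e < a + b + c - 2 := by omega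
  have hf : f < a + b + c - 2 := by omega
  have e1 := (h4 ⟨i, hi⟩).1 ((h2 _).2 (by simp; omega))
  have e2 := (h2 ⟨j, hj⟩).1 ((h4 _).2 (by simp; omega))
  have e3 := (h4 ⟨e, he⟩).1 ((h2 _).2 (by simp))
  have e4 := (h2 ⟨f, hf⟩).1 ((h4 _).2 (by simp))
  simp only at e1 e2 e3 e4
  have : i = j := by omega
  subst this
  ext v
  rw [h1, h3]

lemma rel_inj (ha : 3 ≤ a) (hb : 3 ≤ b) (hc : 2 ≤ c) (hk : 3 ≤ k) (hS : Conn2 a b c S)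
    (hT : Conn2 a b c T) (h0 : ∃ z ∈ U, z.1 = 0)
    (r1 : MRel a b c k S U) (r2 : MRel a b c k T U) : S = T := by
  rcases r1 with ⟨-, r1⟩ | r1 | r1 <;> rcases r2 with ⟨-, r2⟩ | r2 | r2
  · rw [← r1, r2]
  · exact (rel_12 ha hb hc (r1 ▸ hS) h0 r2).elim
  · exact (rel_13 ha hb hc hk (r1 ▸ hS) h0 r2).elim
  · exact (rel_12 ha hb hc (r2 ▸ hT) h0 r1).elim
  · obtain ⟨p0, ⟨z, hz, hza⟩, -, p1⟩ := r1
    obtain ⟨q0, ⟨w, hw, hwa⟩, -, q1⟩ := r2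
    ext v
    by_cases hv : v.1 = a
    · rw [show v = z from Fin.ext (by omega)]
      have : z = w := Fin.ext (by omega)
      exact ⟨fun _ => this ▸ hw, fun _ => hz⟩
    · have h1 := p1 v
      have h2 := q1 v
      have h3 := p0 v
      have h4 := q0 v
      tauto
  · exact (rel_23 ha hb hc hk hS r1 r2).elim
  · exact (rel_13 ha hb hc hk (r2 ▸ hT) h0 r1).elim
  · exact (rel_23 ha hb hc hk hT r2 r1).elim
  · exact rel_33 ha hb hc hk r1 r2

end

lemma B_conn {n : ℕ} {S : Finset (Fin n)} {z : Fin n} (hz : z ∈ S)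
    (h : ∀ v ∈ S, v ≠ z → (Bgraph n).Adj z v) :
    ((Bgraph n).induce (S : Set (Fin n))).Connected := by
  rw [SimpleGraph.connected_iff_exists_forall_reachable]
  refine ⟨⟨z, hz⟩, fun w => ?_⟩
  by_cases hw : w.1 = z
  · have : w = ⟨z, hz⟩ := Subtype.ext hw
    rw [this]
  · exact SimpleGraph.Adj.reachable (by simpa using h w.1 w.2 hw)

lemma B_conn0 {n : ℕ} {S : Finset (Fin n)} (h0 : ∃ z ∈ S, z.1 = 0) :
    ((Bgraph n).induce (S : Set (Fin n))).Connected := by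
  obtain ⟨z, hz, hz0⟩ := h0
  refine B_conn hz fun v hv hne => ?_
  rw [Bgraph, SimpleGraph.fromRel_adj]
  exact ⟨hne.symm, Or.inl (Or.inl hz0)⟩

lemma case3 {a b c k : ℕ} (ha : 3 ≤ a) (hb : 3 ≤ b) (hc : 2 ≤ c) (hk : 3 ≤ k) :
    connCount (G2graph a b c) k ≤ connCount (Bgraph (a + b + c - 2)) k := by
  unfold connCount
  choose f h1 h2 h3 using fun S : {S : Finset (Fin (a + b + c - 2)) //
    S.card = k ∧ ((G2graph a b c).induce (S : Set _)).Connected} =>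
    rel_exists ha hb hc hk S.2.1 S.2.2
  refine Nat.card_le_card_of_injective (fun S => ⟨f S, h1 S, B_conn0 (h2 S)⟩) ?_
  intro S T hST
  have hST : f S = f T := congrArg Subtype.val hST
  exact Subtype.ext (rel_inj ha hb hc hk S.2.2 T.2.2 (h2 T) (hST ▸ h3 S) (h3 T))

lemma case1 {n : ℕ} (G : SimpleGraph (Fin n)) : connCount G 1 ≤ connCount (Bgraph n) 1 := by
  unfold connCount
  refine Nat.card_le_card_of_injective (fun S => ⟨S.1, S.2.1, ?_⟩) ?_
  · obtain ⟨z, hz⟩ := Finset.card_eq_one.1 S.2.1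
    rw [hz]
    refine B_conn (z := z) (by simp) ?_
    intro v hv hne
    exact absurd (by simpa using hv) hne
  · intro S T hST
    exact Subtype.ext (congrArg Subtype.val hST :)

lemma B2 {n : ℕ} (hn : 7 ≤ n) : n + 1 ≤ connCount (Bgraph n) 2 := by
  unfold connCount
  have hc : Nat.card (Fin (n + 1)) = n + 1 := by simp
  conv_lhs => rw [← hc]
  let p : ℕ → ℕ := fun i => if i + 1 < n then 0 else 1
  let q : ℕ → ℕ := fun i => if i + 1 < n then i + 1 else if i + 1 = n then 2 else n - 1
  have hp : ∀ i, p i < n := by intro i; simp only [p]; split_ifs <;> omega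
  have hq : ∀ i, q i < n := by intro i; simp only [q]; split_ifs <;> omega
  have hpq : ∀ i, p i < q i := by intro i; simp only [p, q]; split_ifs <;> omega
  refine Nat.card_le_card_of_injective (fun i : Fin (n + 1) =>
    ⟨{⟨p i, hp i⟩, ⟨q i, hq i⟩}, ?_, ?_⟩) ?_
  · rw [Finset.card_pair]
    have := hpq i
    simp only [ne_eq, Fin.ext_iff]
    omega
  · refine B_conn (z := ⟨p i, hp i⟩) (by simp) ?_
    intro v hv hne
    have hv : v = ⟨q i, hq i⟩ := by
      simp only [Finset.mem_insert, Finset.mem_singleton] at hv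
      tauto
    subst hv
    rw [Bgraph, SimpleGraph.fromRel_adj]
    refine ⟨hne.symm, ?_⟩
    simp only [p, q]
    split_ifs <;> simp
  · intro i j hij
    have hij := congrArg Subtype.val hij
    simp only at hij
    have e1 : (⟨p i, hp i⟩ : Fin n) ∈ ({⟨p j, hp j⟩, ⟨q j, hq j⟩} : Finset (Fin n)) := by
      rw [← hij]; simp
    have e2 : (⟨q i, hq i⟩ : Fin n) ∈ ({⟨p j, hp j⟩, ⟨q j, hq j⟩} : Finset (Fin n)) := by
      rw [← hij]; simp
    have e3 : (⟨p j, hp j⟩ : Fin n) ∈ ({⟨p i, hp i⟩, ⟨q i, hq i⟩} : Finset (Fin n)) := by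
      rw [hij]; simp
    simp only [Finset.mem_insert, Finset.mem_singleton, Fin.ext_iff] at e1 e2 e3
    have := hpq i
    have := hpq j
    apply Fin.ext
    have hi := i.2
    have hj := j.2
    have e4 : p i = p j := by omega
    have e5 : q i = q j := by omega
    simp only [p, q] at e4 e5
    split_ifs at e4 e5 <;> omega

lemma G22 {a b c : ℕ} (ha : 3 ≤ a) (hb : 3 ≤ b) (hc : 2 ≤ c) :
    connCount (G2graph a b c) 2 ≤ a + b + c - 2 + 1 := by
  unfold connCount
  have hcc : Nat.card (Fin (a + b + c - 2 + 1)) = a + b + c - 2 + 1 := by simp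
  conv_rhs => rw [← hcc]
  have key : ∀ S : {S : Finset (Fin (a + b + c - 2)) //
      S.card = 2 ∧ ((G2graph a b c).induce (S : Set _)).Connected},
      ∃ x y : Fin (a + b + c - 2), S.1 = {x, y} ∧ Erel a b c x.1 y.1 := by
    intro S
    obtain ⟨x, y, hxy, hS⟩ := Finset.card_eq_two.1 S.2.1
    obtain ⟨u, hu, v, hv, h1, h2, h3⟩ := cross S.2.2 (fun v => v = x) (x := x) (y := y)
      (by simp [hS]) (by simp [hS]) rfl hxy.symm
    try simp only at h1 h2
    have hv : v = y := by
      rw [hS] at hv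
      simp only [Finset.mem_insert, Finset.mem_singleton] at hv
      tauto
    subst hv h1
    rcases ((adj_iff _ _ _ _ _).1 h3).2 with h | h
    · exact ⟨_, _, hS, h⟩
    · exact ⟨_, _, by rw [hS, Finset.pair_comm], h⟩
  choose x y h1 h2 using key
  let g : ℕ → ℕ → ℕ := fun x y =>
    if x = 0 ∧ (y = a ∨ y = a + b) then a + b + c - 2 else x
  refine Nat.card_le_card_of_injective (fun S => ⟨g (x S) (y S), ?_⟩) ?_
  · have := (x S).2
    simp only [g]
    split_ifs <;> omega
  · intro S T hST
    have hST := congrArg Fin.val hST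
    simp only [g] at hST
    have e1 := h2 S
    have e2 := h2 T
    have l1 := (x S).2
    have l2 := (x T).2
    have l3 := (y S).2
    have l4 := (y T).2
    unfold Erel at e1 e2
    have : (x S).1 = (x T).1 ∧ (y S).1 = (y T).1 := by
      split_ifs at hST <;> omega
    apply Subtype.ext
    rw [h1 S, h1 T, Fin.ext this.1, Fin.ext this.2]

/-- For `a, b ≥ 3` and `c ≥ 2` with `n = a + b + c − 2 ≥ 7`,
`S_k(G₂(a,b,c)) ≤ S_k(B_n)` for every `k ≥ 1`. -/
theorem connCount_G2_le_Bgraph (a b c : ℕ) (ha : 3 ≤ a) (hb : 3 ≤ b) (hc : 2 ≤ c)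
    (hn : 7 ≤ a + b + c - 2) :
    ∀ k, 1 ≤ k → connCount (G2graph a b c) k ≤ connCount (Bgraph (a + b + c - 2)) k := by
  intro k hk
  obtain rfl | rfl | hk : k = 1 ∨ k = 2 ∨ 3 ≤ k := by omega
  · exact case1 _
  · exact (G22 ha hb hc).trans (B2 hn)
  · exact case3 ha hb hc hk
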